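/- (Arbiter policy iteration, monotonicity.) Let (S, A, 𝒜, p, r, γ) be a finite soft MDP. Given an initial policy π⁰, define inductively: Q^l is the unique fixed point of T^{π^l}, and π^{l+1}(a|s) = exp Q^l(s,a) / Σ_{a' ∈ 𝒜(s)} exp Q^l(s,a') for a ∈ 𝒜(s), with π^{l+1}(a|s) = 0 for a ∉ 𝒜(s). Then the sequence of Q-functions improves monotonically: Q^{l+1}(s,a) ≥ Q^l(s,a) for all l ≥ 0, s ∈ S, a ∈ A. -/

import Mathlib

/-- A finite soft MDP: finite nonempty state space `S`, finite action space `A`,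
nonempty allowed-action sets, a transition kernel, a reward, and a discount `0 ≤ γ < 1`. -/
structure SoftMDP (S A : Type) [Fintype S] [Fintype A] where
  act : S → Finset A
  act_nonempty : ∀ s, (act s).Nonempty
  p : S → A → S → ℝ
  p_nonneg : ∀ s a s', 0 ≤ p s a s'
  p_sum_one : ∀ s a, ∑ s', p s a s' = 1
  r : S → A → ℝ
  γ : ℝ
  γ_nonneg : 0 ≤ γ
  γ_lt_one : γ < 1

/-- A policy: a probability mass function `π(·|s)` on `A` for each state `s`,
supported on the allowed actions `𝒜(s)`. -/
structure Policy {S A : Type} [Fintype S] [Fintype A] (M : SoftMDP S A) where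
  pi : S → A → ℝ
  pi_nonneg : ∀ s a, 0 ≤ pi s a
  pi_sum_one : ∀ s, ∑ a, pi s a = 1
  pi_support : ∀ s a, a ∉ M.act s → pi s a = 0

/-- The on-policy soft Bellman backup operator:
`(T^π Q)(s,a) = r(s,a) + γ ∑_{s'} p(s,a,s') ∑_{a'} π(a'|s') (Q(s',a') − log π(a'|s'))`,
where terms with `π(a'|s') = 0` contribute `0` (as the product vanishes). -/
noncomputable def softBellmanPi {S A : Type} [Fintype S] [Fintype A]
    (M : SoftMDP S A) (π : Policy M) (Q : S → A → ℝ) : S → A → ℝ :=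
  fun s a => M.r s a + M.γ * ∑ s', M.p s a s' *
    ∑ a', π.pi s' a' * (Q s' a' - Real.log (π.pi s' a'))


/-- The Gibbs inequality: the entropy-regularized value of a policy is at most the log-partition
function over the allowed actions. -/
theorem Policy.sum_mul_sub_log_le {S A : Type} [Fintype S] [Fintype A]
    {M : SoftMDP S A} (π : Policy M) (q : A → ℝ) (s : S) :
    ∑ a, π.pi s a * (q a - Real.log (π.pi s a)) ≤
      Real.log (∑ a ∈ M.act s, Real.exp (q a)) := by
  classical
  set Z := ∑ a ∈ M.act s, Real.exp (q a) with hZ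
  have hZpos : 0 < Z := Finset.sum_pos (fun a _ => Real.exp_pos _) (M.act_nonempty s)
  have hterm : ∀ a, π.pi s a * (q a - Real.log (π.pi s a)) ≤
      π.pi s a * Real.log Z + ((if a ∈ M.act s then Real.exp (q a) / Z else 0) - π.pi s a) := by
    intro a
    by_cases ha : a ∈ M.act s
    · rw [if_pos ha]
      rcases (π.pi_nonneg s a).eq_or_lt with h0 | hpos
      · rw [← h0]
        have := div_pos (Real.exp_pos (q a)) hZpos
        linarith
      · have hlog := Real.log_le_sub_one_of_pos
          (div_pos (div_pos (Real.exp_pos (q a)) hZpos) hpos)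
        rw [Real.log_div (div_pos (Real.exp_pos _) hZpos).ne' hpos.ne',
          Real.log_div (Real.exp_pos _).ne' hZpos.ne', Real.log_exp] at hlog
        have hmul := mul_le_mul_of_nonneg_left hlog hpos.le
        have hcancel : π.pi s a * (Real.exp (q a) / Z / π.pi s a - 1) =
            Real.exp (q a) / Z - π.pi s a := by
          field_simp
        rw [hcancel] at hmul
        linarith
    · simp [ha, π.pi_support s a ha]
  refine (Finset.sum_le_sum fun a _ => hterm a).trans_eq ?_
  rw [Finset.sum_add_distrib, Finset.sum_sub_distrib, ← Finset.sum_mul, π.pi_sum_one,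
    Finset.sum_ite_mem, Finset.univ_inter, ← Finset.sum_div, ← hZ, div_self hZpos.ne']
  ring

/-- The Boltzmann policy attains equality in the Gibbs inequality. -/
theorem Policy.sum_mul_sub_log_eq_of_boltzmann {S A : Type} [Fintype S] [Fintype A]
    [DecidableEq A] {M : SoftMDP S A} (π : Policy M) (q : A → ℝ) (s : S)
    (hπ : ∀ a, π.pi s a =
      if a ∈ M.act s then Real.exp (q a) / ∑ a' ∈ M.act s, Real.exp (q a') else 0) :
    ∑ a, π.pi s a * (q a - Real.log (π.pi s a)) =
      Real.log (∑ a ∈ M.act s, Real.exp (q a)) := by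
  have hZpos : 0 < ∑ a ∈ M.act s, Real.exp (q a) :=
    Finset.sum_pos (fun a _ => Real.exp_pos _) (M.act_nonempty s)
  have hterm : ∀ a, π.pi s a * (q a - Real.log (π.pi s a)) =
      π.pi s a * Real.log (∑ a ∈ M.act s, Real.exp (q a)) := by
    intro a
    by_cases ha : a ∈ M.act s
    · have hlog : Real.log (π.pi s a) = q a - Real.log (∑ a ∈ M.act s, Real.exp (q a)) := by
        rw [hπ a, if_pos ha, Real.log_div (Real.exp_pos _).ne' hZpos.ne', Real.log_exp]
      rw [hlog, sub_sub_cancel]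
    · simp [π.pi_support s a ha]
  rw [Finset.sum_congr rfl fun a _ => hterm a, ← Finset.sum_mul, π.pi_sum_one, one_mul]

/-- A pointwise bound `Q - Q' ≤ D` is contracted by the discount under the backup operator. -/
theorem softBellmanPi_le_add {S A : Type} [Fintype S] [Fintype A]
    (M : SoftMDP S A) (π : Policy M) {Q Q' : S → A → ℝ} {D : ℝ}
    (h : ∀ s a, Q s a ≤ Q' s a + D) (s : S) (a : A) :
    softBellmanPi M π Q s a ≤ softBellmanPi M π Q' s a + M.γ * D := by
  have hval : ∀ s', ∑ a', π.pi s' a' * (Q s' a' - Real.log (π.pi s' a')) ≤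
      (∑ a', π.pi s' a' * (Q' s' a' - Real.log (π.pi s' a'))) + D := by
    intro s'
    calc ∑ a', π.pi s' a' * (Q s' a' - Real.log (π.pi s' a'))
        ≤ ∑ a', (π.pi s' a' * (Q' s' a' - Real.log (π.pi s' a')) + π.pi s' a' * D) := by
          refine Finset.sum_le_sum fun a' _ => ?_
          rw [← mul_add]
          exact mul_le_mul_of_nonneg_left (by linarith [h s' a']) (π.pi_nonneg s' a')
      _ = _ := by rw [Finset.sum_add_distrib, ← Finset.sum_mul, π.pi_sum_one, one_mul]
  have hsum := Finset.sum_le_sum fun s' (_ : s' ∈ Finset.univ) =>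
    mul_le_mul_of_nonneg_left (hval s') (M.p_nonneg s a s')
  simp only [mul_add] at hsum
  rw [Finset.sum_add_distrib, ← Finset.sum_mul, M.p_sum_one, one_mul] at hsum
  have hγ := mul_le_mul_of_nonneg_left hsum M.γ_nonneg
  rw [mul_add] at hγ
  unfold softBellmanPi
  linarith

/-- A function that increases under the backup operator lies below the fixed point. -/
theorem le_of_le_softBellmanPi {S A : Type} [Fintype S] [Fintype A]
    (M : SoftMDP S A) (π : Policy M) {Q Q' : S → A → ℝ}
    (hQ : ∀ s a, Q s a ≤ softBellmanPi M π Q s a) (hQ' : softBellmanPi M π Q' = Q')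
    (s : S) (a : A) : Q s a ≤ Q' s a := by
  have : Nonempty (S × A) := ⟨(s, a)⟩
  obtain ⟨x, hx⟩ := Finite.exists_max fun x : S × A => Q x.1 x.2 - Q' x.1 x.2
  have hcontr := softBellmanPi_le_add M π (Q := Q) (Q' := Q')
    (D := Q x.1 x.2 - Q' x.1 x.2)
    (fun s a => by linarith [hx (s, a)]) x.1 x.2
  rw [hQ'] at hcontr
  have hD : Q x.1 x.2 - Q' x.1 x.2 ≤ 0 := by
    nlinarith [hQ x.1 x.2, M.γ_lt_one]
  linarith [hx (s, a)]

/-- Arbiter policy iteration, monotonicity: given an initial policy `π⁰`,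
let `Q^l` be the fixed point of `T^{π^l}` and let `π^{l+1}` be the Boltzmann policy of
`Q^l` restricted to the allowed actions. Then `Q^{l+1}(s,a) ≥ Q^l(s,a)` for all `l, s, a`. -/
theorem soft_policy_iteration_monotone {S A : Type} [Fintype S] [Fintype A] [DecidableEq A]
    (M : SoftMDP S A) (πseq : ℕ → Policy M) (Qseq : ℕ → S → A → ℝ)
    (hfix : ∀ l, softBellmanPi M (πseq l) (Qseq l) = Qseq l)
    (himp : ∀ l s a, (πseq (l + 1)).pi s a =
      if a ∈ M.act s then
        Real.exp (Qseq l s a) / ∑ a' ∈ M.act s, Real.exp (Qseq l s a')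
      else 0) :
    ∀ l s a, Qseq l s a ≤ Qseq (l + 1) s a := by
  intro l
  refine le_of_le_softBellmanPi M (πseq (l + 1)) (fun s a => ?_) (hfix (l + 1))
  conv_lhs => rw [← hfix l]
  refine add_le_add le_rfl (mul_le_mul_of_nonneg_left
    (Finset.sum_le_sum fun s' _ => mul_le_mul_of_nonneg_left ?_ (M.p_nonneg s a s')) M.γ_nonneg)
  rw [(πseq (l + 1)).sum_mul_sub_log_eq_of_boltzmann (Qseq l s') s' (himp l s')]
  exact (πseq l).sum_mul_sub_log_le (Qseq l s') s'
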